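/- Let θ : [0,∞)×Ω̄ → (0,∞) and v : [0,∞)×Ω̄ → ℝ^d be smooth, with ∇θ·n = 0 on (0,∞)×∂Ω, and suppose θ_t − Δθ = −ν θ div v in (0,∞)×Ω. Then for every t > 0, (1/2) d/dt ∫_Ω |∇θ|²/θ dx ≤ −∫_Ω θ |∇² log θ|² dx − (ν/2) ∫_Ω (|∇θ|²/θ) div v dx + ν ∫_Ω Δθ div v dx, where ∇² denotes the spatial Hessian. -/

import Mathlib

open MeasureTheory Real Filter Set
open scoped Topology

noncomputable section

/-- Euclidean space `ℝ^d`. -/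
abbrev Ed (d : ℕ) := EuclideanSpace ℝ (Fin d)

/-- Partial derivative of a scalar function in the `i`-th coordinate direction. -/
def pd {d : ℕ} (i : Fin d) (f : Ed d → ℝ) (x : Ed d) : ℝ :=
  fderiv ℝ f x (EuclideanSpace.single i 1)

/-- Divergence of a vector field. -/
def divg {d : ℕ} (w : Ed d → Ed d) (x : Ed d) : ℝ :=
  ∑ i, pd i (fun y => w y i) x

/-- Laplacian of a scalar function. -/
def lap {d : ℕ} (f : Ed d → ℝ) (x : Ed d) : ℝ :=
  ∑ i, pd i (fun y => pd i f y) x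

/-- Squared euclidean norm of the gradient of a scalar function. -/
def gradNormSq {d : ℕ} (f : Ed d → ℝ) (x : Ed d) : ℝ :=
  ∑ i, (pd i f x) ^ 2

/-- Squared Frobenius norm of the Hessian of a scalar function. -/
def hessNormSq {d : ℕ} (f : Ed d → ℝ) (x : Ed d) : ℝ :=
  ∑ i, ∑ j, (pd i (fun y => pd j f y) x) ^ 2

/-- The antisymmetric curl two-form `(curl w)ᵢⱼ = ∂ᵢ wⱼ - ∂ⱼ wᵢ`. -/
def curlM {d : ℕ} (w : Ed d → Ed d) (x : Ed d) (i j : Fin d) : ℝ :=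
  pd i (fun y => w y j) x - pd j (fun y => w y i) x

/-- `|curl w|²`: in dimension 2 (scalar curl) and 3 (vector curl) this equals
the squared norm of the curl. -/
def curlNormSq {d : ℕ} (w : Ed d → Ed d) (x : Ed d) : ℝ :=
  (1 / 2) * ∑ i, ∑ j, (curlM w x i j) ^ 2

/-- `j`-th component of `curl curl w` (in dimensions 2 and 3 this is
`∑ i ∂ᵢ (∂ⱼ wᵢ - ∂ᵢ wⱼ) = ∂ⱼ (div w) - Δ wⱼ`). -/
def ccurl {d : ℕ} (w : Ed d → Ed d) (x : Ed d) (j : Fin d) : ℝ :=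
  ∑ i, pd i (fun y => curlM w y j i) x

/-- `j`-th component of the componentwise Laplacian of a vector field. -/
def veclap {d : ℕ} (w : Ed d → Ed d) (x : Ed d) (j : Fin d) : ℝ :=
  ∑ i, pd i (fun y => pd i (fun z => w z j) y) x

/-- Time derivative of a time-dependent field. -/
def tder {α : Type*} {F : Type*} [NormedAddCommGroup F] [NormedSpace ℝ F]
    (u : ℝ → α → F) : ℝ → α → F :=
  fun t x => deriv (fun s => u s x) t

/-- An open, bounded, convex domain in `ℝ^d` (`d ∈ {2,3}`) together with its outward
unit normal field `n` on the boundary.  For a convex body with smooth boundary the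
outward unit normal at a boundary point is characterized by the supporting
half-space inequality. -/
structure GoodDomain (d : ℕ) (Ω : Set (Ed d)) (n : Ed d → Ed d) : Prop where
  dims : d = 2 ∨ d = 3
  isOpen : IsOpen Ω
  bounded : Bornology.IsBounded Ω
  convex : Convex ℝ Ω
  nonempty : Ω.Nonempty
  normal_unit : ∀ x ∈ frontier Ω, ‖n x‖ = 1
  normal_outward : ∀ x ∈ frontier Ω, ∀ y ∈ closure Ω, ∑ i, (y i - x i) * n x i ≤ 0

/-- A smooth solution `(u, θ)` of the thermoelastic system
`u_tt - (2μ+λ)∇(div u) + μ curl curl u = -ν∇θ`, `θ_t - Δθ = -ν θ div u_t`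
with boundary conditions `u·n = 0`, `𝒩u = 0` (encoded as `(curl u) n = 0`,
which in dimension 2 means `curl u = 0` and in dimension 3 means
`curl u × n = 0`) and `∇θ·n = 0`, and with positive temperature. -/
structure IsSolution {d : ℕ} (Ω : Set (Ed d)) (n : Ed d → Ed d)
    (μ lam ν : ℝ) (u : ℝ → Ed d → Ed d) (θ : ℝ → Ed d → ℝ) : Prop where
  smooth_u : ContDiff ℝ (⊤ : ℕ∞) (fun p : ℝ × Ed d => u p.1 p.2)
  smooth_θ : ContDiff ℝ (⊤ : ℕ∞) (fun p : ℝ × Ed d => θ p.1 p.2)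
  theta_pos : ∀ t : ℝ, 0 ≤ t → ∀ x ∈ closure Ω, 0 < θ t x
  wave : ∀ t : ℝ, 0 < t → ∀ x ∈ Ω, ∀ j : Fin d,
    tder (tder u) t x j - (2 * μ + lam) * pd j (divg (u t)) x
      + μ * ccurl (u t) x j = -ν * pd j (θ t) x
  heat : ∀ t : ℝ, 0 < t → ∀ x ∈ Ω,
    tder θ t x - lap (θ t) x = -ν * θ t x * divg (tder u t) x
  bc_u : ∀ t : ℝ, 0 < t → ∀ x ∈ frontier Ω, ∑ i, u t x i * n x i = 0
  bc_N : ∀ t : ℝ, 0 < t → ∀ x ∈ frontier Ω, ∀ i : Fin d,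
    ∑ j, curlM (u t) x i j * n x j = 0
  bc_θ : ∀ t : ℝ, 0 < t → ∀ x ∈ frontier Ω, ∑ i, pd i (θ t) x * n x i = 0

/-- The functional `F(u, u_t, θ)` built from the Fisher information and
higher-order derivatives of the displacement. -/
def Ffun {d : ℕ} (Ω : Set (Ed d)) (μ lam : ℝ)
    (u : ℝ → Ed d → Ed d) (θ : ℝ → Ed d → ℝ) (t : ℝ) : ℝ :=
  (1 / 2) * ((∫ x in Ω, (divg (tder u t) x) ^ 2)
    + (∫ x in Ω, curlNormSq (tder u t) x)
    + (2 * μ + lam) * (∫ x in Ω, gradNormSq (divg (u t)) x)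
    + μ * (∫ x in Ω, ∑ j, (ccurl (u t) x j) ^ 2)
    + (∫ x in Ω, gradNormSq (θ t) x / θ t x))

/-- The small-data condition
`‖div v₀‖² + ‖curl v₀‖² + (2μ+λ)‖∇div u₀‖² + μ‖curl curl u₀‖² + ‖∇θ₀/√θ₀‖² ≤ D`. -/
def smallData {d : ℕ} (Ω : Set (Ed d)) (μ lam : ℝ)
    (u0 v0 : Ed d → Ed d) (θ0 : Ed d → ℝ) (D : ℝ) : Prop :=
  (∫ x in Ω, (divg v0 x) ^ 2) + (∫ x in Ω, curlNormSq v0 x)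
    + (2 * μ + lam) * (∫ x in Ω, gradNormSq (divg u0) x)
    + μ * (∫ x in Ω, ∑ j, (ccurl u0 x j) ^ 2)
    + (∫ x in Ω, gradNormSq θ0 x / θ0 x) ≤ D

/-- The norm `‖w‖_H = (‖div w‖² + ‖curl w‖²)^{1/2}`. -/
def Hnorm {d : ℕ} (Ω : Set (Ed d)) (w : Ed d → Ed d) : ℝ :=
  Real.sqrt ((∫ x in Ω, (divg w x) ^ 2) + (∫ x in Ω, curlNormSq w x))

end

section Gauge

variable {E : Type*} [NormedAddCommGroup E] [InnerProductSpace ℝ E] {Ω : Set E}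

/-- The outward normal at a boundary point of a convex body containing the origin, rescaled to
pair to one with that point, is dominated by the gauge. -/
lemma exists_dual_le_gauge_of_support (ho : IsOpen Ω) (h0 : (0 : E) ∈ Ω) {y m : E} (hm : m ≠ 0)
    (hsupp : ∀ z ∈ closure Ω, inner ℝ (z - y) m ≤ 0) :
    ∃ c > 0, (∀ z, c * inner ℝ z m ≤ gauge Ω z) ∧ c * inner ℝ y m = 1 := by
  have hpos : 0 < inner ℝ y m := by
    have hev : ∀ᶠ ε : ℝ in 𝓝[>] 0, ε • m ∈ Ω := by
      have hc : Tendsto (fun ε : ℝ => ε • m) (𝓝[>] 0) (𝓝 0) := by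
        have : Continuous fun ε : ℝ => ε • m := by fun_prop
        simpa using (this.tendsto 0).mono_left nhdsWithin_le_nhds
      exact hc (ho.mem_nhds h0)
    obtain ⟨ε, hε, hε0⟩ := (hev.and self_mem_nhdsWithin).exists
    have h1 := hsupp _ (subset_closure hε)
    rw [inner_sub_left, real_inner_smul_left] at h1
    have h2 : 0 < ε * inner ℝ m m := mul_pos hε0 (real_inner_self_pos.2 hm)
    linarith
  refine ⟨(inner ℝ y m)⁻¹, inv_pos.2 hpos, fun z => ?_, inv_mul_cancel₀ hpos.ne'⟩
  refine le_of_forall_gt_imp_ge_of_dense fun a ha => ?_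
  obtain ⟨b, hb, hba, z', hz', rfl⟩ :=
    exists_lt_of_gauge_lt (absorbent_nhds_zero (ho.mem_nhds h0)) ha
  have h1 := hsupp _ (subset_closure hz')
  rw [inner_sub_left] at h1
  have h2 : (inner ℝ y m)⁻¹ * inner ℝ z' m ≤ 1 := by
    rw [inv_mul_le_iff₀ hpos]; linarith
  simp only [real_inner_smul_left]
  nlinarith

/-- A linear form dominated by the gauge and touching it at a point of differentiability is the
derivative of the gauge. -/
lemma eq_of_hasFDerivAt_gauge {L M : E →L[ℝ] ℝ} {y : E} (hL : HasFDerivAt (gauge Ω) L y)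
    (hM : ∀ z, M z ≤ gauge Ω z) (hy : M y = gauge Ω y) : L = M := by
  have hmin : IsLocalMin (fun z => gauge Ω z - M z) y := by
    refine Eventually.of_forall fun z => ?_
    have := hM z
    simp only [hy, sub_self]
    linarith
  exact sub_eq_zero.1 (hmin.hasFDerivAt_eq_zero (hL.sub M.hasFDerivAt))

lemma HasFDerivAt.gauge_smul {L : E →L[ℝ] ℝ} {x : E} (hL : HasFDerivAt (gauge Ω) L x) {a : ℝ}
    (ha : 0 < a) : HasFDerivAt (gauge Ω) L (a • x) := by
  have h1 : (gauge Ω) = fun z => a * gauge Ω (a⁻¹ • z) := by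
    ext z
    rw [gauge_smul_of_nonneg (inv_nonneg.2 ha.le), smul_eq_mul, mul_inv_cancel_left₀ ha.ne']
  have h2 : HasFDerivAt (fun z : E => a⁻¹ • z) (a⁻¹ • ContinuousLinearMap.id ℝ E) (a • x) :=
    (hasFDerivAt_id _).const_smul _
  have h3 : HasFDerivAt (gauge Ω) L (a⁻¹ • a • x) := by rwa [inv_smul_smul₀ ha.ne']
  have h4 := (h3.comp (a • x) h2).const_mul a
  rw [h1]
  refine h4.congr_fderiv ?_
  ext v
  simp [ha.ne']

/-- A vector field tangential to the boundary of a convex body satisfies, at smooth boundary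
points, the sign condition of the second fundamental form. -/
lemma fderiv_tangential_le_zero (ho : IsOpen Ω) (hc : Convex ℝ Ω) (h0 : (0 : E) ∈ Ω) {n : E → E}
    (hn : ∀ x ∈ frontier Ω, n x ≠ 0)
    (hsupp : ∀ x ∈ frontier Ω, ∀ z ∈ closure Ω, inner ℝ (z - x) (n x) ≤ 0)
    {G : E → E} (hG : ∀ x ∈ frontier Ω, inner ℝ (G x) (n x) = 0) {y : E} (hy : y ∈ frontier Ω)
    {G' : E →L[ℝ] E} (hG' : HasFDerivAt G G' y) {L : E →L[ℝ] ℝ}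
    (hL : HasFDerivAt (gauge Ω) L y) : L (G y) = 0 ∧ L (G' (G y)) ≤ 0 := by
  have hnhds : Ω ∈ 𝓝 (0 : E) := ho.mem_nhds h0
  -- for every boundary point a supporting form
  have hform : ∀ x ∈ frontier Ω, ∃ M : E →L[ℝ] ℝ, (∀ z, M z ≤ gauge Ω z) ∧ M x = 1 ∧
      M (G x) = 0 := by
    intro x hx
    obtain ⟨c, -, h1, h2⟩ := exists_dual_le_gauge_of_support ho h0 (hn x hx) (hsupp x hx)
    refine ⟨c • (innerSL ℝ (n x)), fun z => ?_, ?_, ?_⟩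
    · simpa [real_inner_comm] using h1 z
    · simpa [real_inner_comm] using h2
    · have := hG x hx
      rw [real_inner_comm] at this
      simp [this]
  have hgy : gauge Ω y = 1 := (gauge_eq_one_iff_mem_frontier hc hnhds).2 hy
  obtain ⟨K, hK⟩ := hc.lipschitz_gauge hnhds
  have hKle : ∀ z, gauge Ω z ≤ K * ‖z‖ := fun z => by
    simpa [Real.dist_eq, abs_of_nonneg (gauge_nonneg z)] using hK.dist_le_mul z 0
  set b := G y with hb
  obtain ⟨M₀, hM₀, hM₀y, hM₀b⟩ := hform y hy
  have hLM : L = M₀ := eq_of_hasFDerivAt_gauge hL hM₀ (by rw [hM₀y, hgy])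
  have hLb : L b = 0 := by rw [hLM, hM₀b]
  have hLle : ∀ z, L z ≤ gauge Ω z := by rw [hLM]; exact hM₀
  have hLy : L y = 1 := by rw [hLM, hM₀y]
  refine ⟨hLb, ?_⟩
  set c := G' b with hcdef
  let q : ℝ → ℝ := fun s => gauge Ω (y + s • b)
  have hline : ∀ v : E, HasDerivAt (fun s : ℝ => y + s • v) v 0 := fun v => by
    simpa using ((hasDerivAt_id (0 : ℝ)).smul_const v).const_add y
  have hL0 : ∀ v : E, HasFDerivAt (gauge Ω) L (y + (0 : ℝ) • v) := fun v => by simpa using hL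
  have hq : HasDerivAt q 0 0 := by
    have := (hL0 b).comp_hasDerivAt (0 : ℝ) (hline b)
    rwa [hLb] at this
  have hq0 : q 0 = 1 := by simp [q, hgy]
  have hq1 : ∀ s, 1 ≤ q s := fun s => by
    have := hLle (y + s • b)
    simpa [hLy, hLb] using this
  let Y : ℝ → E := fun s => (q s)⁻¹ • (y + s • b)
  have hY : HasDerivAt Y b 0 := by
    have := (hq.inv (by rw [hq0]; norm_num)).smul (hline b)
    exact this.congr_deriv (by simp [hq0])
  have hY0 : Y 0 = y := by simp [Y, hq0]
  have hYfr : ∀ s, Y s ∈ frontier Ω := fun s => by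
    rw [← gauge_eq_one_iff_mem_frontier hc hnhds]
    have hp : 0 < q s := lt_of_lt_of_le one_pos (hq1 s)
    simp only [Y]
    rw [gauge_smul_of_nonneg (inv_nonneg.2 hp.le), smul_eq_mul]
    exact inv_mul_cancel₀ hp.ne'
  have hGY : HasDerivAt (fun s => G (Y s)) c 0 := by
    have h : HasFDerivAt G G' (Y 0) := by rwa [hY0]
    exact h.comp_hasDerivAt (0 : ℝ) hY
  let Φ : ℝ → ℝ := fun s => q s - gauge Ω (y + s • (b - c))
  have hΦ : HasDerivAt Φ (L c) 0 := by
    have := hq.sub ((hL0 (b - c)).comp_hasDerivAt (0 : ℝ) (hline (b - c)))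
    exact this.congr_deriv (by simp [hLb])
  have hΦ0 : Φ 0 = 0 := by simp [Φ, q]
  have hkey : ∀ s : ℝ, 0 < s → Φ s ≤ K * ‖G (Y s) - b - s • c‖ := by
    intro s hs
    obtain ⟨M, hMle, hMY, hMG⟩ := hform _ (hYfr s)
    have hp : 0 < q s := lt_of_lt_of_le one_pos (hq1 s)
    have hMq : M (y + s • b) = q s := by
      have : y + s • b = q s • Y s := by simp [Y, smul_smul, hp.ne']
      rw [this, map_smul, hMY, smul_eq_mul, mul_one]
    have hMb : 0 ≤ s * M b := by
      have h1 := hMle y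
      have h2 := hq1 s
      rw [hgy] at h1
      rw [map_add, map_smul, smul_eq_mul] at hMq
      linarith
    have hMb' : 0 ≤ M b := nonneg_of_mul_nonneg_right hMb hs
    have h3 := hMle (y + s • (b - c))
    have h4 : M (y + s • (b - c)) = q s - s * M c := by
      rw [← hMq]; simp; ring
    have h5 : M (-(G (Y s) - b - s • c)) = M b + s * M c := by
      simp [hMG, add_comm]
    have h6 := (hMle (-(G (Y s) - b - s • c))).trans (hKle _)
    rw [norm_neg] at h6
    simp only [Φ]
    linarith
  have hlim1 : Tendsto (fun s : ℝ => s⁻¹ * Φ s) (𝓝[>] 0) (𝓝 (L c)) := by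
    have := hΦ.tendsto_slope_zero_right
    simpa [hΦ0] using this
  have hlim2 : Tendsto (fun s : ℝ => K * ‖s⁻¹ • (G (Y s) - b) - c‖) (𝓝[>] 0) (𝓝 0) := by
    have h := hGY.tendsto_slope_zero_right
    simp only [zero_add, hY0] at h
    have h2 := ((h.sub_const c).norm).const_mul (K : ℝ)
    simpa using h2
  refine le_of_tendsto_of_tendsto hlim1 hlim2 ?_
  filter_upwards [self_mem_nhdsWithin] with s hs
  have hs' : (0 : ℝ) < s := hs
  have h1 := mul_le_mul_of_nonneg_left (hkey s hs') (inv_nonneg.2 hs'.le)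
  refine h1.trans (le_of_eq ?_)
  have h2 : s⁻¹ • (G (Y s) - b) - c = s⁻¹ • (G (Y s) - b - s • c) := by
    rw [smul_sub _ _ (s • c), inv_smul_smul₀ hs'.ne']
  rw [h2, norm_smul, Real.norm_of_nonneg (inv_nonneg.2 hs'.le)]
  ring

end Gauge

section DivergenceInequality

variable {d : ℕ} {Ω : Set (Ed d)}

/-- The partial cutoff `min 1 (k (1 - p))⁺`, with `p` the gauge of `Ω`. -/
noncomputable def gaugeCutoff (Ω : Set (Ed d)) (k : ℝ) (x : Ed d) : ℝ :=
  max 0 (min 1 (k * (1 - gauge Ω x)))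

lemma gaugeCutoff_nonneg (k : ℝ) (x : Ed d) : 0 ≤ gaugeCutoff Ω k x := le_max_left _ _

lemma gaugeCutoff_le_one (k : ℝ) (x : Ed d) : gaugeCutoff Ω k x ≤ 1 :=
  max_le zero_le_one (min_le_left _ _)

lemma lipschitzWith_gaugeCutoff (hc : Convex ℝ Ω) (hnhds : Ω ∈ 𝓝 0) (k : ℝ) :
    ∃ C, LipschitzWith C (gaugeCutoff Ω k) := by
  obtain ⟨K, hK⟩ := hc.lipschitz_gauge hnhds
  have h1 : LipschitzWith (‖k‖₊ * (0 + K)) fun x => k * (1 - gauge Ω x) :=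
    (lipschitzWith_smul k).comp ((LipschitzWith.const (1 : ℝ)).sub hK)
  exact ⟨_, (h1.const_min 1).const_max 0⟩

/-- Derivative of the cutoff in terms of the derivative of the gauge. -/
lemma fderiv_gaugeCutoff (hc : Convex ℝ Ω) (hnhds : Ω ∈ 𝓝 0) {k : ℝ} (hk : 0 < k) {x : Ed d}
    {L : Ed d →L[ℝ] ℝ} (hL : HasFDerivAt (gauge Ω) L x) :
    fderiv ℝ (gaugeCutoff Ω k) x =
      if 1 - 1 / k < gauge Ω x ∧ gauge Ω x < 1 then -(k • L) else 0 := by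
  split_ifs with h
  · have hev : gaugeCutoff Ω k =ᶠ[𝓝 x] fun z => k * (1 - gauge Ω z) := by
      have hcont := (continuous_gauge hc hnhds).continuousAt (x := x)
      filter_upwards [hcont.eventually (lt_mem_nhds h.1), hcont.eventually (gt_mem_nhds h.2)]
        with z hz1 hz2
      have h1 : k * (1 - gauge Ω z) ≤ 1 := by
        have : k * (1 - gauge Ω z) ≤ k * (1 / k) := by gcongr; linarith
        rwa [mul_one_div_cancel hk.ne'] at this
      have h2 : 0 ≤ k * (1 - gauge Ω z) := mul_nonneg hk.le (by linarith)
      rw [gaugeCutoff, min_eq_right h1, max_eq_right h2]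
    rw [hev.fderiv_eq]
    refine (((hL.const_sub 1).const_mul k).congr_fderiv ?_).fderiv
    simp
  · by_cases h1 : gauge Ω x < 1
    · have h2 : gauge Ω x ≤ 1 - 1 / k := not_lt.1 fun h3 => h ⟨h3, h1⟩
      have h3 : gaugeCutoff Ω k x = 1 := by
        have : k * (1 / k) ≤ k * (1 - gauge Ω x) := by gcongr; linarith
        rw [mul_one_div_cancel hk.ne'] at this
        rw [gaugeCutoff, min_eq_left this, max_eq_right zero_le_one]
      exact IsLocalMax.fderiv_eq_zero
        (Eventually.of_forall fun z => by rw [h3]; exact gaugeCutoff_le_one k z)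
    · have h3 : gaugeCutoff Ω k x = 0 := by
        have : k * (1 - gauge Ω x) ≤ 0 := mul_nonpos_of_nonneg_of_nonpos hk.le (by linarith)
        exact max_eq_left ((min_le_right _ _).trans this)
      exact IsLocalMin.fderiv_eq_zero
        (Eventually.of_forall fun z => by rw [h3]; exact gaugeCutoff_nonneg k z)

lemma tendsto_gaugeCutoff (hc : Convex ℝ Ω) (ho : IsOpen Ω) (h0 : (0 : Ed d) ∈ Ω) (x : Ed d) :
    Tendsto (fun k : ℕ => gaugeCutoff Ω (k + 1) x) atTop (𝓝 (Ω.indicator 1 x)) := by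
  have hmem := gauge_lt_one_iff_mem_interior (x := x) hc (ho.mem_nhds h0)
  rw [ho.interior_eq] at hmem
  refine tendsto_const_nhds.congr' ?_
  by_cases hx : x ∈ Ω
  · have hlt := hmem.2 hx
    rw [indicator_of_mem hx]
    have htend : Tendsto (fun k : ℕ => ((k : ℝ) + 1) * (1 - gauge Ω x)) atTop atTop :=
      (tendsto_atTop_add_const_right _ _ tendsto_natCast_atTop_atTop).atTop_mul_const (by linarith)
    filter_upwards [htend.eventually_ge_atTop 1] with k hk
    rw [gaugeCutoff, min_eq_left hk, max_eq_right zero_le_one, Pi.one_apply]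
  · rw [indicator_of_notMem hx]
    have hge := not_lt.1 (mt hmem.1 hx)
    refine Eventually.of_forall fun k => (max_eq_left ((min_le_right _ _).trans ?_)).symm
    exact mul_nonpos_of_nonneg_of_nonpos (by positivity) (by linarith)

/-- Boundary layer estimate behind the divergence inequality. -/
lemma cutoff_flux_le (hc : Convex ℝ Ω) (ho : IsOpen Ω) (h0 : (0 : Ed d) ∈ Ω)
    (hb : Bornology.IsBounded Ω) {w : Fin d → Ed d → ℝ}
    (hw : ∀ i, ∃ C, LipschitzWith C (w i))
    (hbd : ∀ y ∈ frontier Ω, ∀ L : Ed d →L[ℝ] ℝ, HasFDerivAt (gauge Ω) L y →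
      ∑ i, w i y * L (EuclideanSpace.single i 1) ≤ 0) :
    ∃ B : ℝ, ∀ k : ℝ, 1 ≤ k → ∀ x, ∀ L : Ed d →L[ℝ] ℝ, HasFDerivAt (gauge Ω) L x →
      -∑ i, fderiv ℝ (gaugeCutoff Ω k) x (EuclideanSpace.single i 1) * w i x ≤
        {x | 1 - 1 / k < gauge Ω x ∧ gauge Ω x < 1}.indicator (fun _ => B) x := by
  have hnhds := ho.mem_nhds h0
  obtain ⟨K, hK⟩ := hc.lipschitz_gauge hnhds
  choose C hC using hw
  obtain ⟨R, hR⟩ := hb.closure.exists_norm_le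
  refine ⟨∑ i, (C i * R) * K, fun k hk x L hL => ?_⟩
  have hk0 : 0 < k := by linarith
  rw [fderiv_gaugeCutoff hc hnhds hk0 hL]
  by_cases h : 1 - 1 / k < gauge Ω x ∧ gauge Ω x < 1
  · rw [if_pos h, indicator_of_mem (by exact h)]
    have hp : 0 < gauge Ω x := by
      have : 1 / k ≤ 1 := by rw [div_le_one hk0]; exact hk
      linarith [h.1]
    set p := gauge Ω x with hpdef
    have hy : p⁻¹ • x ∈ frontier Ω := by
      rw [← gauge_eq_one_iff_mem_frontier hc hnhds, gauge_smul_of_nonneg (inv_nonneg.2 hp.le),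
        smul_eq_mul]
      exact inv_mul_cancel₀ hp.ne'
    set y := p⁻¹ • x with hydef
    have hxy : x = p • y := by rw [hydef, smul_inv_smul₀ hp.ne']
    have hdist : dist x y ≤ R / k := by
      have h1 : x - y = -((1 - p) • y) := by rw [hxy]; module
      have h2 : ‖y‖ ≤ R := hR y (frontier_subset_closure hy)
      rw [dist_eq_norm, h1, norm_neg, norm_smul, Real.norm_of_nonneg (by linarith [h.2])]
      calc (1 - p) * ‖y‖ ≤ (1 / k) * R := by
            gcongr
            linarith [h.1]
        _ = R / k := by ring
    have hLy := hbd y hy L (hL.gauge_smul (inv_pos.2 hp))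
    have hLK : ∀ i, |L (EuclideanSpace.single i 1)| ≤ K := fun i => by
      have h1 : ‖L‖ ≤ K := hL.le_of_lipschitz hK
      have h2 := L.le_opNorm (EuclideanSpace.single i 1)
      rw [show ‖(EuclideanSpace.single i 1 : Ed d)‖ = 1 by simp, mul_one, Real.norm_eq_abs] at h2
      exact h2.trans h1
    have hterm : ∀ i, (w i x - w i y) * L (EuclideanSpace.single i 1) ≤ (C i * R) * K / k := by
      intro i
      have h1 : |w i x - w i y| ≤ C i * (R / k) := by
        rw [← Real.dist_eq]
        exact ((hC i).dist_le_mul x y).trans (by gcongr)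
      calc _ ≤ |(w i x - w i y) * L (EuclideanSpace.single i 1)| := le_abs_self _
        _ = |w i x - w i y| * |L (EuclideanSpace.single i 1)| := abs_mul _ _
        _ ≤ (C i * (R / k)) * K :=
            mul_le_mul h1 (hLK i) (abs_nonneg _) ((abs_nonneg _).trans h1)
        _ = _ := by ring
    calc -∑ i, (-(k • L)) (EuclideanSpace.single i 1) * w i x
        = k * (∑ i, w i y * L (EuclideanSpace.single i 1)
            + ∑ i, (w i x - w i y) * L (EuclideanSpace.single i 1)) := by
          rw [← Finset.sum_add_distrib, Finset.mul_sum, ← Finset.sum_neg_distrib]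
          refine Finset.sum_congr rfl fun i _ => ?_
          simp only [neg_apply, smul_apply, smul_eq_mul]
          ring
      _ ≤ k * (0 + ∑ i, (C i * R) * K / k) := by
          gcongr with i _
          exact hterm i
      _ = ∑ i, (C i * R) * K := by
          rw [zero_add, ← Finset.sum_div, mul_div_cancel₀ _ hk0.ne']
  · rw [if_neg h, indicator_of_notMem (by exact h)]
    simp

/-- Divergence inequality for compactly supported fields on a convex body. -/
lemma integral_div_nonpos_of_hasCompactSupport (hc : Convex ℝ Ω) (ho : IsOpen Ω)
    (h0 : (0 : Ed d) ∈ Ω) (hb : Bornology.IsBounded Ω) {w : Fin d → Ed d → ℝ}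
    (hw : ∀ i, ContDiff ℝ 1 (w i)) (hws : ∀ i, HasCompactSupport (w i))
    (hbd : ∀ y ∈ frontier Ω, ∀ L : Ed d →L[ℝ] ℝ, HasFDerivAt (gauge Ω) L y →
      ∑ i, w i y * L (EuclideanSpace.single i 1) ≤ 0) :
    ∫ x in Ω, ∑ i, pd i (w i) x ≤ 0 := by
  have hnhds := ho.mem_nhds h0
  have hwL : ∀ i, ∃ C, LipschitzWith C (w i) := fun i =>
    (hw i).lipschitzWith_of_hasCompactSupport (hws i) one_ne_zero
  obtain ⟨B, hB⟩ := cutoff_flux_le hc ho h0 hb hwL hbd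
  obtain ⟨K, hK⟩ := hc.lipschitz_gauge hnhds
  have hpcont : ∀ i, Continuous (pd i (w i)) := fun i =>
    ((hw i).continuous_fderiv one_ne_zero).clm_apply continuous_const
  have hpint : ∀ i, Integrable (pd i (w i)) := fun i =>
    (hpcont i).integrable_of_hasCompactSupport ((hws i).fderiv_apply ℝ _)
  have hdivint : Integrable fun x => ∑ i, pd i (w i) x :=
    integrable_finsetSum _ fun i _ => hpint i
  have hχcont : ∀ k, Continuous (gaugeCutoff Ω k) := fun k =>
    (lipschitzWith_gaugeCutoff hc hnhds k).choose_spec.continuous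
  let A : ℝ → Set (Ed d) := fun k => {x | 1 - 1 / k < gauge Ω x ∧ gauge Ω x < 1}
  have hAmeas : ∀ k, MeasurableSet (A k) := fun k =>
    ((isOpen_lt continuous_const (continuous_gauge hc hnhds)).inter
      (isOpen_lt (continuous_gauge hc hnhds) continuous_const)).measurableSet
  have hAΩ : ∀ k, A k ⊆ Ω := fun k x hx => by
    have := (gauge_lt_one_iff_mem_interior hc hnhds).1 hx.2
    rwa [ho.interior_eq] at this
  have hΩfin : volume Ω ≠ ⊤ := hb.measure_lt_top.ne
  have hAint : ∀ k, Integrable ((A k).indicator fun _ => B) := fun k =>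
    (integrable_indicator_iff (hAmeas k)).2
      (integrableOn_const (ne_top_of_le_ne_top hΩfin (measure_mono (hAΩ k))))
  have hle : ∀ k : ℕ, ∫ x, gaugeCutoff Ω (k + 1) x * ∑ i, pd i (w i) x ≤
      ∫ x, (A (k + 1)).indicator (fun _ => B) x := by
    intro k
    set χ := gaugeCutoff Ω ((k : ℝ) + 1) with hχdef
    obtain ⟨C, hC⟩ := lipschitzWith_gaugeCutoff hc hnhds ((k : ℝ) + 1)
    have hparts : ∀ i, ∫ x, χ x * pd i (w i) x =
        -∫ x, lineDeriv ℝ χ x (EuclideanSpace.single i 1) * w i x := by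
      intro i
      obtain ⟨D, hD⟩ := hwL i
      rw [hC.integral_lineDeriv_mul_eq hD (hws i), ← integral_neg]
      refine integral_congr_ae (Eventually.of_forall fun x => ?_)
      have := ((hw i).differentiable one_ne_zero x).lineDeriv_eq_fderiv
        (v := -EuclideanSpace.single i 1)
      simp only [this, map_neg, pd]
      ring
    have hint1 : ∀ i, Integrable fun x => χ x * pd i (w i) x := fun i =>
      ((hχcont _).mul (hpcont i)).integrable_of_hasCompactSupport
        (((hws i).fderiv_apply ℝ _).mul_left)
    have hint2 : ∀ i, Integrable fun x => lineDeriv ℝ χ x (EuclideanSpace.single i 1) * w i x :=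
      fun i => (hC.locallyIntegrable_lineDeriv _).integrable_smul_right_of_hasCompactSupport
        (hw i).continuous (hws i)
    simp_rw [Finset.mul_sum]
    rw [integral_finsetSum _ fun i _ => hint1 i]
    simp_rw [hparts]
    rw [Finset.sum_neg_distrib, ← integral_finsetSum _ fun i _ => hint2 i, ← integral_neg]
    refine integral_mono_ae (integrable_finsetSum _ fun i _ => hint2 i).neg (hAint _) ?_
    filter_upwards [hC.ae_differentiableAt, hK.ae_differentiableAt] with x hx1 hx2
    have := hB (k + 1) (by simp) x _ hx2.hasFDerivAt
    have hline : ∀ i : Fin d, lineDeriv ℝ χ x (EuclideanSpace.single i 1) =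
        fderiv ℝ χ x (EuclideanSpace.single i 1) := fun i => hx1.lineDeriv_eq_fderiv
    simpa only [hline] using this
  have hlim1 : Tendsto (fun k : ℕ => ∫ x, gaugeCutoff Ω (k + 1) x * ∑ i, pd i (w i) x) atTop
      (𝓝 (∫ x in Ω, ∑ i, pd i (w i) x)) := by
    rw [← integral_indicator ho.measurableSet]
    refine tendsto_integral_of_dominated_convergence (fun x => ‖∑ i, pd i (w i) x‖)
      (fun k => (hχcont _).aestronglyMeasurable.mul hdivint.aestronglyMeasurable) hdivint.norm
      (fun k => Eventually.of_forall fun x => ?_) (Eventually.of_forall fun x => ?_)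
    · rw [norm_mul, Real.norm_of_nonneg (gaugeCutoff_nonneg _ _)]
      exact mul_le_of_le_one_left (norm_nonneg _) (gaugeCutoff_le_one _ _)
    · have := (tendsto_gaugeCutoff hc ho h0 x).mul_const (∑ i, pd i (w i) x)
      by_cases hx : x ∈ Ω <;> simpa [hx] using this
  have hlim2 : Tendsto (fun k : ℕ => ∫ x, (A (k + 1)).indicator (fun _ => B) x) atTop (𝓝 0) := by
    rw [← integral_zero (Ed d) ℝ]
    refine tendsto_integral_of_dominated_convergence (Ω.indicator fun _ => ‖B‖)
      (fun k => (hAint _).aestronglyMeasurable)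
      ((integrable_indicator_iff ho.measurableSet).2 (integrableOn_const hΩfin))
      (fun k => Eventually.of_forall fun x => ?_) (Eventually.of_forall fun x => ?_)
    · rw [norm_indicator_eq_indicator_norm]
      exact indicator_le_indicator_of_subset (hAΩ _) (fun _ => norm_nonneg _) x
    · refine tendsto_const_nhds.congr' ?_
      by_cases hx : gauge Ω x < 1
      · have h1 : Tendsto (fun k : ℕ => 1 - 1 / ((k : ℝ) + 1)) atTop (𝓝 (1 - 0)) :=
          tendsto_one_div_add_atTop_nhds_zero_nat.const_sub 1
        rw [sub_zero] at h1
        filter_upwards [h1.eventually (lt_mem_nhds hx)] with k hk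
        exact (indicator_of_notMem (fun h => (lt_asymm h.1 hk)) _).symm
      · exact Eventually.of_forall fun k => (indicator_of_notMem (fun h => hx h.2) _).symm
  exact le_of_tendsto_of_tendsto' hlim1 hlim2 hle

end DivergenceInequality

section PartialDerivatives

open scoped ContDiff

variable {d : ℕ} {f g : Ed d → ℝ} {x : Ed d}

lemma ContinuousLinearMap.apply_eq_sum_single (L : Ed d →L[ℝ] ℝ) (v : Ed d) :
    L v = ∑ i, v i * L (EuclideanSpace.single i 1) := by
  conv_lhs => rw [← (EuclideanSpace.basisFun (Fin d) ℝ).sum_repr v]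
  simp

lemma ContDiffAt.pd (hf : ContDiffAt ℝ ∞ f x) (i : Fin d) : ContDiffAt ℝ ∞ (pd i f) x :=
  (hf.fderiv_right (m := ∞) (by simp)).clm_apply contDiffAt_const

lemma ContDiff.pd (hf : ContDiff ℝ ∞ f) (i : Fin d) : ContDiff ℝ ∞ (pd i f) :=
  contDiff_iff_contDiffAt.2 fun _ => hf.contDiffAt.pd i

lemma pd_congr (h : f =ᶠ[𝓝 x] g) (i : Fin d) : pd i f x = pd i g x := by
  simp only [pd, h.fderiv_eq]

lemma pd_mul (hf : DifferentiableAt ℝ f x) (hg : DifferentiableAt ℝ g x) (i : Fin d) :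
    pd i (fun y => f y * g y) x = f x * pd i g x + g x * pd i f x := by
  simp [pd, fderiv_fun_mul hf hg]

lemma pd_sub (hf : DifferentiableAt ℝ f x) (hg : DifferentiableAt ℝ g x) (i : Fin d) :
    pd i (fun y => f y - g y) x = pd i f x - pd i g x := by
  simp [pd, fderiv_fun_sub hf hg]

lemma pd_const_mul (hf : DifferentiableAt ℝ f x) (c : ℝ) (i : Fin d) :
    pd i (fun y => c * f y) x = c * pd i f x := by
  simp [pd, fderiv_const_mul hf]

lemma pd_sum {ι : Type*} {s : Finset ι} {F : ι → Ed d → ℝ}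
    (hF : ∀ k ∈ s, DifferentiableAt ℝ (F k) x) (i : Fin d) :
    pd i (fun y => ∑ k ∈ s, F k y) x = ∑ k ∈ s, pd i (F k) x := by
  simp [pd, fderiv_fun_sum hF]

lemma pd_inv (hf : DifferentiableAt ℝ f x) (h : f x ≠ 0) (i : Fin d) :
    pd i (fun y => (f y)⁻¹) x = -pd i f x / f x ^ 2 := by
  have h1 := ((hasDerivAt_inv h).comp_hasFDerivAt x hf.hasFDerivAt).fderiv
  have h2 : (Inv.inv ∘ f) = fun y => (f y)⁻¹ := rfl
  rw [h2] at h1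
  simp only [pd, h1, smul_apply, smul_eq_mul]
  ring

lemma pd_div (hf : DifferentiableAt ℝ f x) (hg : DifferentiableAt ℝ g x) (h : g x ≠ 0)
    (i : Fin d) :
    pd i (fun y => f y / g y) x = pd i f x / g x - f x * pd i g x / g x ^ 2 := by
  simp only [div_eq_mul_inv (f _)]
  rw [pd_mul hf (hg.fun_inv h), pd_inv hg h]
  ring

lemma pd_sq (hf : DifferentiableAt ℝ f x) (i : Fin d) :
    pd i (fun y => f y ^ 2) x = 2 * f x * pd i f x := by
  simp only [pow_two]
  rw [pd_mul hf hf]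
  ring

lemma pd_log (hf : DifferentiableAt ℝ f x) (h : f x ≠ 0) (i : Fin d) :
    pd i (fun y => Real.log (f y)) x = pd i f x / f x := by
  simp only [pd, fderiv.log hf h, smul_apply, smul_eq_mul]
  ring

lemma pd_comm (hf : ContDiffAt ℝ ∞ f x) (i j : Fin d) :
    pd i (pd j f) x = pd j (pd i f) x := by
  have hsymm : IsSymmSndFDerivAt ℝ f x :=
    hf.isSymmSndFDerivAt (by simpa using WithTop.coe_le_coe.2 (le_top : (2 : ℕ∞) ≤ ⊤))
  have hd : DifferentiableAt ℝ (fderiv ℝ f) x :=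
    (hf.fderiv_right (m := ∞) (by simp)).differentiableAt (by simp)
  have h : ∀ k l : Fin d, pd k (pd l f) x =
      fderiv ℝ (fderiv ℝ f) x (EuclideanSpace.single k 1) (EuclideanSpace.single l 1) := by
    intro k l
    change fderiv ℝ (fun y => fderiv ℝ f y (EuclideanSpace.single l 1)) x _ = _
    rw [fderiv_clm_apply hd (differentiableAt_const _)]
    simp
  rw [h, h]
  exact hsymm _ _

lemma pd_comp_const_add (a : Ed d) (i : Fin d) :
    pd i (fun y => f (a + y)) x = pd i f (a + x) := by
  simp only [pd, fderiv_comp_add_left]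

lemma pd_sq_div (hf : DifferentiableAt ℝ f x) (hg : DifferentiableAt ℝ g x) (h : g x ≠ 0)
    (i : Fin d) :
    pd i (fun y => f y ^ 2 / g y) x =
      2 * (f x * pd i f x / g x) - f x ^ 2 / g x * (pd i g x / g x) := by
  rw [pd_div (hf.fun_pow 2) hg h, pd_sq hf]
  ring

lemma pd_pd_sq_div (hf : ContDiff ℝ ∞ f) (hg : ContDiff ℝ ∞ g) (h : g x ≠ 0) (i : Fin d) :
    pd i (pd i (fun y => f y ^ 2 / g y)) x =
      2 * (pd i f x ^ 2 + f x * pd i (pd i f) x) / g x - 4 * f x * pd i f x * pd i g x / g x ^ 2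
        - f x ^ 2 * pd i (pd i g) x / g x ^ 2 + 2 * f x ^ 2 * pd i g x ^ 2 / g x ^ 3 := by
  have hev : pd i (fun y => f y ^ 2 / g y) =ᶠ[𝓝 x] fun y =>
      2 * (f y * pd i f y / g y) - f y ^ 2 / g y * (pd i g y / g y) := by
    filter_upwards [hg.continuous.continuousAt.eventually_ne h] with y hy
    exact pd_sq_div (hf.differentiable (by simp) y) (hg.differentiable (by simp) y) hy i
  have df := hf.differentiable (by simp) x
  have dg := hg.differentiable (by simp) x
  have dpf := (hf.pd i).differentiable (by simp) x
  have dpg := (hg.pd i).differentiable (by simp) x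
  have d1 : DifferentiableAt ℝ (fun y => f y * pd i f y / g y) x := by
    fun_prop (disch := assumption)
  have d2 : DifferentiableAt ℝ (fun y => f y ^ 2 / g y) x := by
    fun_prop (disch := assumption)
  have d3 : DifferentiableAt ℝ (fun y => pd i g y / g y) x := by
    fun_prop (disch := assumption)
  rw [pd_congr hev, pd_sub (d1.const_mul 2) (d2.fun_mul d3), pd_const_mul d1,
    pd_div (df.fun_mul dpf) dg h, pd_mul df dpf, pd_mul d2 d3, pd_div dpg dg h, pd_sq_div df dg h]
  field_simp
  ring

lemma pd_pd_log (hf : ContDiff ℝ ∞ f) (h : f x ≠ 0) (i j : Fin d) :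
    pd i (pd j (fun y => Real.log (f y))) x =
      pd i (pd j f) x / f x - pd j f x * pd i f x / f x ^ 2 := by
  have hev : pd j (fun y => Real.log (f y)) =ᶠ[𝓝 x] fun y => pd j f y / f y := by
    filter_upwards [hf.continuous.continuousAt.eventually_ne h] with y hy
    exact pd_log (hf.differentiable (by simp) y) hy j
  rw [pd_congr hev, pd_div ((hf.pd j).differentiable (by simp) x) (hf.differentiable (by simp) x) h]

/-- Bochner-type identity for the Fisher information density. -/
lemma lap_gradNormSq_div (hf : ContDiff ℝ ∞ f) (h : f x ≠ 0) :
    lap (fun y => gradNormSq f y / f y) x =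
      2 * (∑ i, pd i f x * pd i (lap f) x) / f x - gradNormSq f x * lap f x / f x ^ 2
        + 2 * (f x * hessNormSq (fun y => Real.log (f y)) x) := by
  have hk : ∀ i, ContDiffAt ℝ ∞ (fun y => pd i f y ^ 2 / f y) x := fun i =>
    ((hf.pd i).pow 2).contDiffAt.div hf.contDiffAt h
  have hlap : ∀ i, pd i (lap f) x = ∑ j, pd j (pd j (pd i f)) x := by
    intro i
    change pd i (fun y => ∑ j, pd j (pd j f) y) x = _
    rw [pd_sum fun j _ => ((hf.pd j).pd j).differentiable (by simp) x]
    refine Finset.sum_congr rfl fun j _ => ?_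
    rw [pd_comm (hf.pd j).contDiffAt]
    exact pd_congr (Eventually.of_forall fun y => pd_comm hf.contDiffAt i j) j
  have hsum : ∀ j, pd j (pd j (fun y => gradNormSq f y / f y)) x =
      ∑ i, pd j (pd j (fun y => pd i f y ^ 2 / f y)) x := by
    intro j
    have hev : pd j (fun y => gradNormSq f y / f y) =ᶠ[𝓝 x]
        fun y => ∑ i, pd j (fun y => pd i f y ^ 2 / f y) y := by
      filter_upwards [hf.continuous.continuousAt.eventually_ne h] with y hy
      simp only [gradNormSq, Finset.sum_div]
      exact pd_sum (fun i _ =>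
        (((hf.pd i).pow 2).contDiffAt.div hf.contDiffAt hy).differentiableAt (by simp)) j
    rw [pd_congr hev, pd_sum fun i _ => ((hk i).pd j).differentiableAt (by simp)]
  have hterm : ∀ i j, pd j (pd j (fun y => pd i f y ^ 2 / f y)) x =
      2 * (pd i f x * pd j (pd j (pd i f)) x) / f x - pd i f x ^ 2 * pd j (pd j f) x / f x ^ 2
        + 2 * (f x * pd i (pd j (fun y => Real.log (f y))) x ^ 2) := by
    intro i j
    rw [pd_pd_sq_div (hf.pd i) hf h, pd_pd_log hf h, pd_comm hf.contDiffAt i j]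
    field_simp
    ring
  have hlhs : lap (fun y => gradNormSq f y / f y) x =
      ∑ i, ∑ j, pd j (pd j (fun y => pd i f y ^ 2 / f y)) x := by
    rw [Finset.sum_comm]
    exact Finset.sum_congr rfl fun j _ => hsum j
  rw [hlhs]
  simp_rw [hterm, hlap]
  simp only [Finset.sum_add_distrib, Finset.sum_sub_distrib, gradNormSq, lap, hessNormSq,
    Finset.mul_sum, Finset.sum_div, Finset.sum_mul]
  congr 2
  exact Finset.sum_comm

end PartialDerivatives

section NeumannFields

open scoped ContDiff

variable {d : ℕ} {Ω : Set (Ed d)} {n : Ed d → Ed d}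

/-- Divergence inequality for fields that are continuously differentiable up to the boundary. -/
lemma integral_div_nonpos (hc : Convex ℝ Ω) (ho : IsOpen Ω) (h0 : (0 : Ed d) ∈ Ω)
    (hb : Bornology.IsBounded Ω) {w : Fin d → Ed d → ℝ}
    (hw : ∀ i, ∀ x ∈ closure Ω, ContDiffAt ℝ 1 (w i) x)
    (hbd : ∀ y ∈ frontier Ω, ∀ L : Ed d →L[ℝ] ℝ, HasFDerivAt (gauge Ω) L y →
      ∑ i, w i y * L (EuclideanSpace.single i 1) ≤ 0) :
    ∫ x in Ω, ∑ i, pd i (w i) x ≤ 0 := by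
  let U : Set (Ed d) := {x | ∀ i, ContDiffAt ℝ 1 (w i) x}
  have hU : IsOpen U := isOpen_iff_mem_nhds.2 fun x hx =>
    eventually_all.2 fun i => (hx i).eventually (by simp)
  have hcpt : IsCompact (closure Ω) := hb.isCompact_closure
  obtain ⟨K, hK, hΩK, hKU⟩ := exists_compact_between hcpt hU fun x hx i => hw i x hx
  obtain ⟨η, hη, -, hsupp, hone⟩ := exists_contMDiff_support_eq_eq_one_iff (n := 1)
    (modelWithCornersSelf ℝ (Ed d)) isOpen_interior isClosed_closure hΩK
  have hη' : ContDiff ℝ 1 η := hη.contDiff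
  have hts : tsupport η ⊆ K := by
    rw [tsupport, hsupp]
    exact closure_minimal interior_subset hK.isClosed
  have hηc : HasCompactSupport η := hK.of_isClosed_subset (isClosed_tsupport η) hts
  have hone' : ∀ x ∈ closure Ω, η x = 1 := fun x hx => (hone x).1 hx
  have hcd : ∀ i, ContDiff ℝ 1 fun x => η x * w i x := by
    refine fun i => contDiff_iff_contDiffAt.2 fun x => ?_
    by_cases hx : x ∈ tsupport η
    · exact hη'.contDiffAt.mul (hKU (hts hx) i)
    · refine (contDiffAt_const (c := (0 : ℝ))).congr_of_eventuallyEq ?_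
      filter_upwards [notMem_tsupport_iff_eventuallyEq.1 hx] with z hz
      simp [hz]
  have key := integral_div_nonpos_of_hasCompactSupport hc ho h0 hb hcd
    (fun i => hηc.mul_right) fun y hy L hL => by
      simpa only [hone' y (frontier_subset_closure hy), one_mul] using hbd y hy L hL
  refine le_of_eq_of_le (setIntegral_congr_fun ho.measurableSet fun x hx => ?_) key
  refine Finset.sum_congr rfl fun i _ => pd_congr ?_ i
  filter_upwards [ho.mem_nhds hx] with z hz
  rw [hone' z (subset_closure hz), one_mul]

lemma GoodDomain.translate (hdom : GoodDomain d Ω n) (a : Ed d) :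
    GoodDomain d ((fun x => a + x) ⁻¹' Ω) fun x => n (a + x) := by
  have hcl : closure ((fun x => a + x) ⁻¹' Ω) = (fun x => a + x) ⁻¹' closure Ω :=
    ((Homeomorph.addLeft a).preimage_closure Ω).symm
  have hfr : frontier ((fun x => a + x) ⁻¹' Ω) = (fun x => a + x) ⁻¹' frontier Ω :=
    ((Homeomorph.addLeft a).preimage_frontier Ω).symm
  refine ⟨hdom.dims, hdom.isOpen.preimage (by fun_prop), ?_,
    hdom.convex.translate_preimage_right a, ?_, ?_, ?_⟩
  · have := (isometry_add_left a).antilipschitz.isBounded_preimage hdom.bounded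
    exact this
  · obtain ⟨x, hx⟩ := hdom.nonempty
    exact ⟨-a + x, by simpa using hx⟩
  · rw [hfr]
    exact fun x hx => hdom.normal_unit _ hx
  · rw [hfr, hcl]
    intro x hx y hy
    simpa using hdom.normal_outward _ hx _ hy

lemma setIntegral_translate (F : Ed d → ℝ) (a : Ed d) :
    ∫ x in (fun x => a + x) ⁻¹' Ω, F (a + x) = ∫ x in Ω, F x :=
  (measurePreserving_add_left volume a).setIntegral_preimage_emb
    (measurableEmbedding_addLeft a) F Ω

/-- Neumann boundary conditions for `f` in terms of the gauge: the gradient is tangential, and its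
derivative along itself points inwards. -/
lemma GoodDomain.neumann_gauge (hdom : GoodDomain d Ω n) (h0 : (0 : Ed d) ∈ Ω) {f : Ed d → ℝ}
    (hf : ContDiff ℝ ∞ f) (hbc : ∀ x ∈ frontier Ω, ∑ i, pd i f x * n x i = 0) {y : Ed d}
    (hy : y ∈ frontier Ω) {L : Ed d →L[ℝ] ℝ} (hL : HasFDerivAt (gauge Ω) L y) :
    ∑ i, pd i f y * L (EuclideanSpace.single i 1) = 0 ∧
      ∑ j, (∑ i, pd i f y * pd j (pd i f) y) * L (EuclideanSpace.single j 1) ≤ 0 := by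
  let G : Ed d → Ed d := fun x => WithLp.toLp 2 fun i => pd i f x
  have hGi : ∀ i, DifferentiableAt ℝ (fun x => G x i) y := fun i =>
    (hf.pd i).differentiable (by simp) y
  have hG : HasFDerivAt G (fderiv ℝ G y) y := (differentiableAt_euclidean.2 hGi).hasFDerivAt
  have key := fderiv_tangential_le_zero hdom.isOpen hdom.convex h0 (n := n)
    (fun x hx hn => by simpa [hn] using hdom.normal_unit x hx)
    (fun x hx z hz => by
      simpa [PiLp.inner_apply, mul_comm] using hdom.normal_outward x hx z hz)
    (G := G) (fun x hx => by simpa [PiLp.inner_apply, G, mul_comm] using hbc x hx) hy hG hL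
  rw [L.apply_eq_sum_single (G y), L.apply_eq_sum_single (fderiv ℝ G y (G y))] at key
  refine ⟨key.1, le_of_eq_of_le (Finset.sum_congr rfl fun j _ => ?_) key.2⟩
  congr 1
  have h1 : HasFDerivAt (fun x => G x j)
      ((EuclideanSpace.proj j : Ed d →L[ℝ] ℝ) ∘L fderiv ℝ G y) y :=
    (EuclideanSpace.proj j : Ed d →L[ℝ] ℝ).hasFDerivAt.comp y hG
  have h2 : fderiv ℝ G y (G y) j = fderiv ℝ (pd j f) y (G y) := by
    change _ = fderiv ℝ (fun x => G x j) y (G y)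
    rw [h1.fderiv]
    rfl
  rw [h2, ContinuousLinearMap.apply_eq_sum_single]
  refine Finset.sum_congr rfl fun i _ => ?_
  rw [pd_comm hf.contDiffAt j i]
  rfl

/-- A smooth multiple of the gradient of a Neumann function has vanishing total divergence. -/
lemma GoodDomain.integral_div_mul_grad (hdom : GoodDomain d Ω n) {f D : Ed d → ℝ}
    (hf : ContDiff ℝ ∞ f) (hD : ContDiff ℝ ∞ D)
    (hbc : ∀ x ∈ frontier Ω, ∑ i, pd i f x * n x i = 0) :
    ∫ x in Ω, ∑ i, pd i (fun y => D y * pd i f y) x = 0 := by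
  obtain ⟨a, ha⟩ := hdom.nonempty
  have hdom' := hdom.translate a
  have hfr : frontier ((fun x => a + x) ⁻¹' Ω) = (fun x => a + x) ⁻¹' frontier Ω :=
    ((Homeomorph.addLeft a).preimage_frontier Ω).symm
  have h0 : (0 : Ed d) ∈ (fun x => a + x) ⁻¹' Ω := by simpa using ha
  have hle : ∀ E : Ed d → ℝ, ContDiff ℝ ∞ E →
      ∫ x in Ω, ∑ i, pd i (fun y => E y * pd i f y) x ≤ 0 := by
    intro E hE
    have hf' : ContDiff ℝ ∞ fun x => f (a + x) := hf.comp (contDiff_const.add contDiff_id)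
    have hE' : ContDiff ℝ ∞ fun x => E (a + x) := hE.comp (contDiff_const.add contDiff_id)
    have := integral_div_nonpos hdom'.convex hdom'.isOpen h0 hdom'.bounded
      (w := fun i x => E (a + x) * pd i (fun x => f (a + x)) x)
      (fun i x _ => (hE'.mul (hf'.pd i)).contDiffAt.of_le (by simp))
      (fun y hy L hL => by
        have h := (hdom'.neumann_gauge h0 hf' (fun x hx => by
          rw [hfr] at hx
          simpa only [pd_comp_const_add] using hbc _ hx) hy hL).1
        simp only [mul_assoc, ← Finset.mul_sum, h, mul_zero, le_refl])
    rw [← setIntegral_translate _ a]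
    refine le_of_eq_of_le (integral_congr_ae (Eventually.of_forall fun x =>
      Finset.sum_congr rfl fun i _ => ?_)) this
    simp only [pd_comp_const_add (f := f)]
    exact (pd_comp_const_add (f := fun y => E y * pd i f y) a i).symm
  refine le_antisymm (hle D hD) ?_
  have hneg := hle (fun y => -1 * D y) (contDiff_const.mul hD)
  have : ∀ x, ∑ i, pd i (fun y => -1 * D y * pd i f y) x =
      -∑ i, pd i (fun y => D y * pd i f y) x := by
    intro x
    rw [← Finset.sum_neg_distrib]
    refine Finset.sum_congr rfl fun i _ => ?_
    simp only [mul_assoc]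
    rw [pd_const_mul ((hD.mul (hf.pd i)).differentiable (by simp) x)]
    ring
  simp only [this, integral_neg] at hneg
  linarith

/-- On a convex domain the total Laplacian of the Fisher density of a positive Neumann function is
nonpositive. -/
lemma GoodDomain.integral_lap_fisher_nonpos (hdom : GoodDomain d Ω n) {f : Ed d → ℝ}
    (hf : ContDiff ℝ ∞ f) (hpos : ∀ x ∈ closure Ω, 0 < f x)
    (hbc : ∀ x ∈ frontier Ω, ∑ i, pd i f x * n x i = 0) :
    ∫ x in Ω, lap (fun y => gradNormSq f y / f y) x ≤ 0 := by
  obtain ⟨a, ha⟩ := hdom.nonempty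
  have hdom' := hdom.translate a
  have hcl : closure ((fun x => a + x) ⁻¹' Ω) = (fun x => a + x) ⁻¹' closure Ω :=
    ((Homeomorph.addLeft a).preimage_closure Ω).symm
  have hfr : frontier ((fun x => a + x) ⁻¹' Ω) = (fun x => a + x) ⁻¹' frontier Ω :=
    ((Homeomorph.addLeft a).preimage_frontier Ω).symm
  have h0 : (0 : Ed d) ∈ (fun x => a + x) ⁻¹' Ω := by simpa using ha
  let g : Ed d → ℝ := fun x => f (a + x)
  have hg : ContDiff ℝ ∞ g := hf.comp (contDiff_const.add contDiff_id)
  have hgpos : ∀ x ∈ closure ((fun x => a + x) ⁻¹' Ω), 0 < g x := by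
    rw [hcl]
    exact fun x hx => hpos _ hx
  have hgrad : ContDiff ℝ ∞ (gradNormSq g) := ContDiff.sum fun i _ => (hg.pd i).pow 2
  have key := integral_div_nonpos hdom'.convex hdom'.isOpen h0 hdom'.bounded
    (w := fun j => pd j (fun y => gradNormSq g y / g y))
    (fun j x hx => ((hgrad.contDiffAt.div hg.contDiffAt (hgpos x hx).ne').pd j).of_le (by simp))
    (fun y hy L hL => by
      have hgy := hgpos y (frontier_subset_closure hy)
      have hb := hdom'.neumann_gauge h0 hg (fun x hx => by
          rw [hfr] at hx
          simpa only [g, pd_comp_const_add] using hbc _ hx) hy hL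
      have hpd : ∀ j, pd j (fun y => gradNormSq g y / g y) y =
          2 / g y * (∑ i, pd i g y * pd j (pd i g) y) - gradNormSq g y / g y ^ 2 * pd j g y := by
        intro j
        rw [pd_div (hgrad.differentiable (by simp) y) (hg.differentiable (by simp) y) hgy.ne']
        have : pd j (gradNormSq g) y = 2 * ∑ i, pd i g y * pd j (pd i g) y := by
          change pd j (fun y => ∑ i, pd i g y ^ 2) y = _
          rw [pd_sum fun i _ => ((hg.pd i).pow 2).differentiable (by simp) y, Finset.mul_sum]
          refine Finset.sum_congr rfl fun i _ => ?_
          rw [pd_sq ((hg.pd i).differentiable (by simp) y), mul_assoc]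
        rw [this]
        ring
      simp only [hpd, sub_mul, Finset.sum_sub_distrib, mul_assoc, ← Finset.mul_sum, hb.1, mul_zero,
        sub_zero]
      exact mul_nonpos_of_nonneg_of_nonpos (by positivity) hb.2)
  rw [← setIntegral_translate _ a]
  refine le_of_eq_of_le (integral_congr_ae (Eventually.of_forall fun x => ?_)) key
  refine Finset.sum_congr rfl fun j _ => ?_
  have h1 : (fun y => gradNormSq g y / g y) = fun y => (fun z => gradNormSq f z / f z) (a + y) := by
    ext y
    simp only [gradNormSq, g, pd_comp_const_add]
  have h2 : pd j (fun y => gradNormSq g y / g y) =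
      fun y => pd j (fun z => gradNormSq f z / f z) (a + y) := by
    rw [h1]
    ext y
    exact pd_comp_const_add (f := fun z => gradNormSq f z / f z) a j
  rw [h2, pd_comp_const_add]

end NeumannFields

section TimeDerivative

open scoped ContDiff

variable {d : ℕ} {Ω : Set (Ed d)} {θ : ℝ → Ed d → ℝ}

lemma ContDiff.time_slice {F : Type*} [NormedAddCommGroup F] [NormedSpace ℝ F]
    {u : ℝ → Ed d → F} (hu : ContDiff ℝ ∞ fun p : ℝ × Ed d => u p.1 p.2) (t : ℝ) :
    ContDiff ℝ ∞ (u t) :=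
  hu.comp (contDiff_prodMk_right t)

lemma pd_eq_fderiv_prod (hθ : ContDiff ℝ ∞ fun p : ℝ × Ed d => θ p.1 p.2) (t : ℝ) (x : Ed d)
    (i : Fin d) :
    pd i (θ t) x =
      fderiv ℝ (fun p : ℝ × Ed d => θ p.1 p.2) (t, x) (0, EuclideanSpace.single i 1) := by
  have h := (hθ.differentiable (by simp) (t, x)).hasFDerivAt.comp x (hasFDerivAt_prodMk_right t x)
  have h' : HasFDerivAt (θ t) _ x := h
  rw [pd, h'.fderiv]
  simp

lemma hasDerivAt_fderiv_prod (hθ : ContDiff ℝ ∞ fun p : ℝ × Ed d => θ p.1 p.2) (t : ℝ) (x : Ed d) :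
    HasDerivAt (fun s => θ s x) (fderiv ℝ (fun p : ℝ × Ed d => θ p.1 p.2) (t, x) (1, 0)) t := by
  have h := HasFDerivAt.comp (f := fun s : ℝ => (s, x)) t
    (hθ.differentiable (by simp) (t, x)).hasFDerivAt (hasFDerivAt_prodMk_left t x)
  have h' : HasFDerivAt (fun s => θ s x) _ t := h
  simpa using h'.hasDerivAt

lemma tder_eq_fderiv_prod (hθ : ContDiff ℝ ∞ fun p : ℝ × Ed d => θ p.1 p.2) (t : ℝ) (x : Ed d) :
    tder θ t x = fderiv ℝ (fun p : ℝ × Ed d => θ p.1 p.2) (t, x) (1, 0) :=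
  (hasDerivAt_fderiv_prod hθ t x).deriv

lemma hasDerivAt_tder (hθ : ContDiff ℝ ∞ fun p : ℝ × Ed d => θ p.1 p.2) (t : ℝ) (x : Ed d) :
    HasDerivAt (fun s => θ s x) (tder θ t x) t :=
  (hasDerivAt_fderiv_prod hθ t x).differentiableAt.hasDerivAt

lemma contDiff_pd_prod (hθ : ContDiff ℝ ∞ fun p : ℝ × Ed d => θ p.1 p.2) (i : Fin d) :
    ContDiff ℝ ∞ fun p : ℝ × Ed d => pd i (θ p.1) p.2 := by
  simp only [pd_eq_fderiv_prod hθ]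
  exact (hθ.fderiv_right (m := ∞) (by simp)).clm_apply contDiff_const

lemma contDiff_tder_prod (hθ : ContDiff ℝ ∞ fun p : ℝ × Ed d => θ p.1 p.2) :
    ContDiff ℝ ∞ fun p : ℝ × Ed d => tder θ p.1 p.2 := by
  simp only [tder_eq_fderiv_prod hθ]
  exact (hθ.fderiv_right (m := ∞) (by simp)).clm_apply contDiff_const

/-- Time and space derivatives of a smooth function commute. -/
lemma hasDerivAt_pd (hθ : ContDiff ℝ ∞ fun p : ℝ × Ed d => θ p.1 p.2) (t : ℝ) (x : Ed d)
    (i : Fin d) : HasDerivAt (fun s => pd i (θ s) x) (pd i (tder θ t) x) t := by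
  have hd : DifferentiableAt ℝ (fderiv ℝ fun p : ℝ × Ed d => θ p.1 p.2) (t, x) :=
    (hθ.fderiv_right (m := ∞) (by simp)).differentiable (by simp) _
  have hsymm : IsSymmSndFDerivAt ℝ (fun p : ℝ × Ed d => θ p.1 p.2) (t, x) :=
    hθ.contDiffAt.isSymmSndFDerivAt (by simpa using WithTop.coe_le_coe.2 (le_top : (2 : ℕ∞) ≤ ⊤))
  have h := hasDerivAt_fderiv_prod (θ := fun s y => pd i (θ s) y) (contDiff_pd_prod hθ i) t x
  convert h using 1
  rw [pd_eq_fderiv_prod (contDiff_tder_prod hθ)]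
  simp only [pd_eq_fderiv_prod hθ, tder_eq_fderiv_prod hθ]
  rw [fderiv_clm_apply hd (differentiableAt_const _), fderiv_clm_apply hd (differentiableAt_const _)]
  simpa using hsymm _ _

/-- Time derivative of the Fisher information density. -/
noncomputable def fisherRate (θ : ℝ → Ed d → ℝ) (t : ℝ) (x : Ed d) : ℝ :=
  2 * (∑ i, pd i (θ t) x * pd i (tder θ t) x) / θ t x
    - gradNormSq (θ t) x * tder θ t x / θ t x ^ 2

lemma hasDerivAt_fisher (hθ : ContDiff ℝ ∞ fun p : ℝ × Ed d => θ p.1 p.2) {t : ℝ} {x : Ed d}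
    (h : θ t x ≠ 0) :
    HasDerivAt (fun s => gradNormSq (θ s) x / θ s x) (fisherRate θ t x) t := by
  have h1 : HasDerivAt (fun s => gradNormSq (θ s) x)
      (∑ i, 2 * (pd i (θ t) x * pd i (tder θ t) x)) t := by
    refine HasDerivAt.fun_sum fun i _ => ?_
    simpa [mul_assoc] using (hasDerivAt_pd hθ t x i).fun_pow 2
  refine (h1.fun_div (hasDerivAt_tder hθ t x) h).congr_deriv ?_
  rw [fisherRate, ← Finset.mul_sum]
  field_simp

/-- Differentiation under the integral over a bounded open set. -/
lemma hasDerivAt_setIntegral_of_continuousOn (ho : IsOpen Ω) (hb : Bornology.IsBounded Ω)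
    {F G : ℝ → Ed d → ℝ} {a b t : ℝ} (ht : t ∈ Ioo a b)
    (hF : ContinuousOn (fun p : ℝ × Ed d => F p.1 p.2) (Icc a b ×ˢ closure Ω))
    (hG : ContinuousOn (fun p : ℝ × Ed d => G p.1 p.2) (Icc a b ×ˢ closure Ω))
    (hFG : ∀ s ∈ Icc a b, ∀ x ∈ Ω, HasDerivAt (fun r => F r x) (G s x) s) :
    HasDerivAt (fun s => ∫ x in Ω, F s x) (∫ x in Ω, G t x) t := by
  have hcpt : IsCompact (closure Ω) := hb.isCompact_closure
  obtain ⟨C, hC⟩ := (isCompact_Icc.prod hcpt).exists_bound_of_continuousOn hG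
  have hslice : ∀ {H : ℝ → Ed d → ℝ},
      ContinuousOn (fun p : ℝ × Ed d => H p.1 p.2) (Icc a b ×ˢ closure Ω) →
      ∀ s ∈ Icc a b, IntegrableOn (H s) Ω := fun {H} hH s hs =>
    (ContinuousOn.integrableOn_compact hcpt (hH.comp (by fun_prop : ContinuousOn
      (fun x => (s, x)) (closure Ω)) fun x hx => ⟨hs, hx⟩)).mono_set subset_closure
  have hn : Icc a b ∈ 𝓝 t := Icc_mem_nhds ht.1 ht.2
  have htI : t ∈ Icc a b := Ioo_subset_Icc_self ht
  refine (hasDerivAt_integral_of_dominated_loc_of_deriv_le (μ := volume.restrict Ω)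
    (bound := fun _ => C) hn ?_ (hslice hF t htI) (hslice hG t htI).aestronglyMeasurable ?_ ?_ ?_).2
  · filter_upwards [hn] with s hs using (hslice hF s hs).aestronglyMeasurable
  · filter_upwards [ae_restrict_mem ho.measurableSet] with x hx s hs
    exact hC (s, x) ⟨hs, subset_closure hx⟩
  · exact integrableOn_const hb.measure_lt_top.ne
  · filter_upwards [ae_restrict_mem ho.measurableSet] with x hx s hs using hFG s hs x hx

lemma hasDerivAt_integral_fisher (ho : IsOpen Ω) (hb : Bornology.IsBounded Ω)
    (hθ : ContDiff ℝ ∞ fun p : ℝ × Ed d => θ p.1 p.2)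
    (hpos : ∀ t : ℝ, 0 ≤ t → ∀ x ∈ closure Ω, 0 < θ t x) {t : ℝ} (ht : 0 < t) :
    HasDerivAt (fun s => ∫ x in Ω, gradNormSq (θ s) x / θ s x)
      (∫ x in Ω, fisherRate θ t x) t := by
  have hne : ∀ p ∈ Icc 0 (2 * t) ×ˢ closure Ω, θ p.1 p.2 ≠ 0 := fun p hp =>
    (hpos p.1 hp.1.1 p.2 hp.2).ne'
  have cθ := hθ.continuous
  have cp := fun i => (contDiff_pd_prod hθ i).continuous
  have ct := (contDiff_tder_prod hθ).continuous
  have cpt := fun i => (contDiff_pd_prod (contDiff_tder_prod hθ) i).continuous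
  have cg : Continuous fun p : ℝ × Ed d => gradNormSq (θ p.1) p.2 :=
    continuous_finsetSum _ fun i _ => (cp i).pow 2
  refine hasDerivAt_setIntegral_of_continuousOn ho hb (a := 0) (b := 2 * t)
    ⟨ht, by linarith⟩ (cg.continuousOn.div cθ.continuousOn hne) ?_
    fun s hs x hx => hasDerivAt_fisher hθ (hpos s hs.1 x (subset_closure hx)).ne'
  refine ContinuousOn.sub (ContinuousOn.div (Continuous.continuousOn ?_) cθ.continuousOn hne)
    (ContinuousOn.div (cg.mul ct).continuousOn (cθ.pow 2).continuousOn
      fun p hp => pow_ne_zero 2 (hne p hp))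
  exact continuous_const.mul (continuous_finsetSum _ fun i _ => (cp i).mul (cpt i))

end TimeDerivative

section FisherRate

open scoped ContDiff

variable {d : ℕ} {Ω : Set (Ed d)} {θ : ℝ → Ed d → ℝ} {ν t : ℝ} {D : Ed d → ℝ}

lemma contDiff_lap {f : Ed d → ℝ} (hf : ContDiff ℝ ∞ f) : ContDiff ℝ ∞ (lap f) :=
  ContDiff.sum fun i _ => (hf.pd i).pd i

/-- Pointwise form of the Fisher dissipation identity for the forced heat equation. -/
lemma half_fisherRate_eq (ho : IsOpen Ω) (hf : ContDiff ℝ ∞ (θ t)) (hD : ContDiff ℝ ∞ D)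
    (hheat : ∀ x ∈ Ω, tder θ t x - lap (θ t) x = -ν * θ t x * D x) {x : Ed d} (hx : x ∈ Ω)
    (h : θ t x ≠ 0) :
    (1 / 2) * fisherRate θ t x =
      (1 / 2) * lap (fun y => gradNormSq (θ t) y / θ t y) x
        - θ t x * hessNormSq (fun y => Real.log (θ t y)) x
        - (ν / 2) * (gradNormSq (θ t) x / θ t x * D x) + ν * (lap (θ t) x * D x)
        - ν * ∑ i, pd i (fun y => D y * pd i (θ t) y) x := by
  have hT : ∀ y ∈ Ω, tder θ t y = lap (θ t) y - ν * (θ t y * D y) := fun y hy => by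
    linarith [hheat y hy]
  have df := hf.differentiable (by simp) x
  have dD := hD.differentiable (by simp) x
  have dl := (contDiff_lap hf).differentiable (by simp) x
  have hpT : ∀ i, pd i (tder θ t) x =
      pd i (lap (θ t)) x - ν * (θ t x * pd i D x + D x * pd i (θ t) x) := by
    intro i
    rw [pd_congr (eventually_of_mem (ho.mem_nhds hx) hT) i,
      pd_sub dl ((df.fun_mul dD).const_mul ν), pd_const_mul (df.fun_mul dD), pd_mul df dD]
  have hdiv : ∑ i, pd i (fun y => D y * pd i (θ t) y) x =
      D x * lap (θ t) x + ∑ i, pd i (θ t) x * pd i D x := by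
    rw [lap, Finset.mul_sum, ← Finset.sum_add_distrib]
    exact Finset.sum_congr rfl fun i _ => pd_mul dD ((hf.pd i).differentiable (by simp) x) i
  have hsum : ∑ i, pd i (θ t) x * pd i (tder θ t) x =
      ∑ i, pd i (θ t) x * pd i (lap (θ t)) x
        - ν * (θ t x * ∑ i, pd i (θ t) x * pd i D x + D x * gradNormSq (θ t) x) := by
    simp only [hpT, gradNormSq, Finset.mul_sum, ← Finset.sum_add_distrib, ← Finset.sum_sub_distrib]
    exact Finset.sum_congr rfl fun i _ => by ring
  rw [fisherRate, hsum, hT x hx, lap_gradNormSq_div hf h, hdiv]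
  field_simp
  ring

end FisherRate

/-- the Fisher-information dissipation inequality for a positive
solution of the forced heat equation with a Neumann boundary condition. -/
theorem fisher_dissipation {d : ℕ} {Ω : Set (Ed d)} {n : Ed d → Ed d} {ν : ℝ}
    (hdom : GoodDomain d Ω n) (θ : ℝ → Ed d → ℝ) (v : ℝ → Ed d → Ed d)
    (hθs : ContDiff ℝ (⊤ : ℕ∞) (fun p : ℝ × Ed d => θ p.1 p.2))
    (hvs : ContDiff ℝ (⊤ : ℕ∞) (fun p : ℝ × Ed d => v p.1 p.2))
    (hpos : ∀ t : ℝ, 0 ≤ t → ∀ x ∈ closure Ω, 0 < θ t x)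
    (hbc : ∀ t : ℝ, 0 < t → ∀ x ∈ frontier Ω, ∑ i, pd i (θ t) x * n x i = 0)
    (heq : ∀ t : ℝ, 0 < t → ∀ x ∈ Ω,
      tder θ t x - lap (θ t) x = -ν * θ t x * divg (v t) x) :
    ∀ t : ℝ, 0 < t → ∃ F' : ℝ,
      HasDerivAt (fun s => ∫ x in Ω, gradNormSq (θ s) x / θ s x) F' t ∧
      (1 / 2) * F' ≤ -(∫ x in Ω, θ t x * hessNormSq (fun y => Real.log (θ t y)) x)
        - (ν / 2) * (∫ x in Ω, (gradNormSq (θ t) x / θ t x) * divg (v t) x)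
        + ν * ∫ x in Ω, lap (θ t) x * divg (v t) x := by
  intro t ht
  have hf := hθs.time_slice t
  have hD : ContDiff ℝ (⊤ : ℕ∞) (divg (v t)) := ContDiff.sum fun i _ =>
    ContDiff.pd (contDiff_euclidean.1 (hvs.time_slice t) i) i
  have hfpos := hpos t ht.le
  refine ⟨_, hasDerivAt_integral_fisher hdom.isOpen hdom.bounded hθs hpos ht, ?_⟩
  have hint : ∀ {H : Ed d → ℝ}, (∀ x ∈ closure Ω, ContinuousAt H x) → IntegrableOn H Ω :=
    fun {H} hH => (ContinuousOn.integrableOn_compact hdom.bounded.isCompact_closure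
      fun x hx => (hH x hx).continuousWithinAt).mono_set subset_closure
  have hgrad : ContDiff ℝ (⊤ : ℕ∞) (gradNormSq (θ t)) := ContDiff.sum fun i _ => (hf.pd i).pow 2
  have hfisher : ∀ x ∈ closure Ω,
      ContDiffAt ℝ (⊤ : ℕ∞) (fun y => gradNormSq (θ t) y / θ t y) x := fun x hx =>
    hgrad.contDiffAt.div hf.contDiffAt (hfpos x hx).ne'
  have hlog : ∀ x ∈ closure Ω, ContDiffAt ℝ (⊤ : ℕ∞) (fun y => Real.log (θ t y)) x :=
    fun x hx => hf.contDiffAt.log (hfpos x hx).ne'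
  have i1 : IntegrableOn (lap fun y => gradNormSq (θ t) y / θ t y) Ω := hint fun x hx =>
    (ContDiffAt.sum fun i _ => ((hfisher x hx).pd i).pd i).continuousAt
  have i2 : IntegrableOn (fun x => θ t x * hessNormSq (fun y => Real.log (θ t y)) x) Ω :=
    hint fun x hx => (hf.contDiffAt.mul (ContDiffAt.sum fun i _ => ContDiffAt.sum fun j _ =>
      (((hlog x hx).pd j).pd i).pow 2)).continuousAt
  have i3 : IntegrableOn (fun x => gradNormSq (θ t) x / θ t x * divg (v t) x) Ω :=
    hint fun x hx => ((hfisher x hx).mul hD.contDiffAt).continuousAt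
  have i4 : IntegrableOn (fun x => lap (θ t) x * divg (v t) x) Ω :=
    hint fun x _ => ((contDiff_lap hf).mul hD).continuous.continuousAt
  have i5 : IntegrableOn (fun x => ∑ i, pd i (fun y => divg (v t) y * pd i (θ t) y) x) Ω :=
    hint fun x _ => (ContDiff.sum fun i _ =>
      (hD.mul (hf.pd i)).pd i).continuous.continuousAt
  have hflux := hdom.integral_div_mul_grad hf hD (hbc t ht)
  have hlap := hdom.integral_lap_fisher_nonpos hf hfpos (hbc t ht)
  have i12 : IntegrableOn (fun x => 1 / 2 * lap (fun y => gradNormSq (θ t) y / θ t y) x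
      - θ t x * hessNormSq (fun y => Real.log (θ t y)) x) Ω := (i1.const_mul _).sub i2
  have i13 : IntegrableOn (fun x => 1 / 2 * lap (fun y => gradNormSq (θ t) y / θ t y) x
      - θ t x * hessNormSq (fun y => Real.log (θ t y)) x
      - ν / 2 * (gradNormSq (θ t) x / θ t x * divg (v t) x)) Ω := i12.sub (i3.const_mul _)
  have i14 := Integrable.fun_add i13 (i4.const_mul ν)
  rw [← integral_const_mul, setIntegral_congr_fun hdom.isOpen.measurableSet fun x hx =>
      half_fisherRate_eq hdom.isOpen hf hD (heq t ht) hx (hfpos x (subset_closure hx)).ne',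
    integral_sub i14 (i5.const_mul ν), integral_add i13 (i4.const_mul ν),
    integral_sub i12 (i3.const_mul (ν / 2)), integral_sub (i1.const_mul (1 / 2)) i2]
  simp only [integral_const_mul]
  rw [hflux]
  linarith
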